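/- Commutation of inc with ε-transitions: if θ₁ →ε θ₂ →inc(S,χ) θ₃ for extended configurations θ₁, θ₂, θ₃, then there exist an extended configuration θ̂₁ with θ̂₁ ∼ θ₁, extended configurations θ', θ'', and a set S' ⊆ Q × TA such that either θ̂₁ →inc(S',χ) θ' →ε θ₃, or θ̂₁ →inc(S',χ) θ' →ε θ'' →ε θ₃. -/

import Mathlib

namespace ECBUDA

/-- Evaluation of a nonempty word under the semigroup homomorphism determined
by the letter map `h` (and `none` on the empty word). -/
def hword {A B S : Type} [Mul S] (h : A × B → S) : List (A × B) → Option S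
  | [] => none
  | c :: w => some (w.foldl (fun s x => s * h x) (h c))

/-- (NF1): the homomorphism takes distinct values on words of length one:
`h(w) = h(c)` iff `w = c`. -/
def NF1 {A B S : Type} [Mul S] (h : A × B → S) : Prop :=
  ∀ (w : List (A × B)) (c : A × B), hword h w = some (h c) ↔ w = [c]

/-- Basic tests allowed in normal form (NF2): state tests, `⟨μ⟩^=`, `⟨μ⟩^≠`
and `root`. -/
inductive NTest (Q S : Type) : Type where
  | state : Q → NTest Q S
  | deq : S → NTest Q S
  | dneq : S → NTest Q S
  | root : NTest Q S

/-- Basic actions. -/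
inductive NAct (Q : Type) : Type where
  | accept : NAct Q
  | keep : Q → NAct Q
  | store : Q → NAct Q
  | guess : Q → NAct Q
  | univ : Q → NAct Q

/-- The set `TA`: possibly negated basic tests (the Boolean flag `true` marks
negation), basic actions, and the three symbols `⊤`, `⊤g`, `⊥`. -/
inductive TA (Q S : Type) : Type where
  | test : Bool → NTest Q S → TA Q S
  | act : NAct Q → TA Q S
  | top : TA Q S
  | topg : TA Q S
  | bot : TA Q S

/-- A transition of the automaton in normal form: a conjunction of possibly
negated basic tests with a conjunction of basic actions. -/
abbrev NTrans (Q S : Type) : Type := List (Bool × NTest Q S) × List (NAct Q)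

/-- An extended configuration `(Δ, Γ, r, m)`: `Δ` a finite set of threads,
`Γ` a finite set of pairs (semigroup element, data value) containing exactly
one pair whose first component is the image under `h` of a letter (this letter
is the label of the configuration and the associated data value its data
value), and Booleans `r` (root) and `m` (merge). -/
structure EConf (A B Q S : Type) (D : Type) (h : A × B → S) : Type where
  Δ : Set (Q × TA Q S × D)
  Γ : Set (S × D)
  r : Bool
  m : Bool
  finΔ : Δ.Finite
  finΓ : Γ.Finite
  uniq : ∃! x : S × D, x ∈ Γ ∧ ∃ c : A × B, x.1 = h c

variable {A B Q S D : Type} {h : A × B → S}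

/-- `Δ(d)`: the threads carrying the data value `d`. -/
def EConf.dfun (θ : EConf A B Q S D h) (d : D) : Set (Q × TA Q S) :=
  {qa | (qa.1, qa.2, d) ∈ θ.Δ}

/-- `Γ(d)`: the semigroup elements of downward paths leading to `d`. -/
def EConf.gfun (θ : EConf A B Q S D h) (d : D) : Set S :=
  {μ | (μ, d) ∈ θ.Γ}

/-- The data values occurring in the extended configuration. -/
def EConf.dataset (θ : EConf A B Q S D h) : Set D :=
  {d | (∃ qa : Q × TA Q S, (qa.1, qa.2, d) ∈ θ.Δ) ∨ ∃ μ : S, (μ, d) ∈ θ.Γ}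

/-- The unique pair of `Γ` recording the label and the data value of the root. -/
def EConf.rootInfo (θ : EConf A B Q S D h) : Set (S × D) :=
  {x ∈ θ.Γ | ∃ c : A × B, x.1 = h c}

/-- The set of data values of the root pair (a singleton). -/
def EConf.rootData (θ : EConf A B Q S D h) : Set D :=
  {d | ∃ μ : S, (μ, d) ∈ θ.Γ ∧ ∃ c : A × B, μ = h c}

/-- The profile `(A₀, A₁, r, m)` of an extended configuration: `Aᵢ` is the set
of those `χ ⊆ S` such that exactly `i` data values `d` satisfy `Γ(d) = χ`. -/
def EConf.profile (θ : EConf A B Q S D h) :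
    Set (Set S) × Set (Set S) × Bool × Bool :=
  ({χ | {d | θ.gfun d = χ}.encard = 0},
   {χ | {d | θ.gfun d = χ}.encard = 1}, θ.r, θ.m)

/-- `θ₁ ⪯_f θ₂`. -/
def pleF (f : D → D) (θ₁ θ₂ : EConf A B Q S D h) : Prop :=
  θ₁.profile = θ₂.profile ∧ θ₁.dataset ⊆ Set.range f ∧
  ∀ d : D, θ₁.dfun (f d) ⊆ θ₂.dfun d ∧ θ₁.gfun (f d) = θ₂.gfun d

/-- The well-quasi-order `⪯` on extended configurations. -/
def ple (θ₁ θ₂ : EConf A B Q S D h) : Prop :=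
  ∃ f : D → D, pleF f θ₁ θ₂

/-- `θ₁ ∼ θ₂`: equal up to a bijection of the data values. -/
def simEquiv (θ₁ θ₂ : EConf A B Q S D h) : Prop :=
  ∃ g : D ≃ D,
    θ₂.Δ = {x | (x.1, x.2.1, g.symm x.2.2) ∈ θ₁.Δ} ∧
    θ₂.Γ = {x | (x.1, g.symm x.2) ∈ θ₁.Γ} ∧
    θ₂.r = θ₁.r ∧ θ₂.m = θ₁.m

/-- The closure of a set of extended configurations under `∼`. -/
def simClose (Θ : Set (EConf A B Q S D h)) : Set (EConf A B Q S D h) :=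
  {θ | ∃ θ' ∈ Θ, simEquiv θ θ'}

/-- `Θ ≤min Θ'`: every member of `Θ'` is minorized by a member of `Θ`. -/
def leMin (Θ Θ' : Set (EConf A B Q S D h)) : Prop :=
  ∀ θ' ∈ Θ', ∃ θ ∈ Θ, ple θ θ'

/-- Satisfaction of a basic test by the thread `(q, d)` in an extended
configuration. -/
def ntestHolds (θ : EConf A B Q S D h) (q : Q) (d : D) : NTest Q S → Prop
  | .state p => q = p
  | .deq μ => (μ, d) ∈ θ.Γ
  | .dneq μ => ∃ e : D, e ≠ d ∧ (μ, e) ∈ θ.Γ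
  | .root => θ.r = true

def taTestHolds (θ : EConf A B Q S D h) (q : Q) (d : D) (neg : Bool)
    (t : NTest Q S) : Prop :=
  if neg then ¬ ntestHolds θ q d t else ntestHolds θ q d t

/-- The tests and actions occurring in a transition, as elements of `TA`. -/
def taSet (tr : NTrans Q S) : Set (TA Q S) :=
  {x | (∃ nt ∈ tr.1, x = TA.test nt.1 nt.2) ∨ ∃ a ∈ tr.2, x = TA.act a}

/-- The ε-transitions of the transition system: they keep `Γ`, `r` (hence the
label and data value), require the merge flag to be false, and rewrite one
thread of `Δ`. -/
def epsStep (δ : List (NTrans Q S)) (θ₁ θ₂ : EConf A B Q S D h) : Prop :=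
  θ₁.m = false ∧ θ₂.m = false ∧ θ₂.r = θ₁.r ∧ θ₂.Γ = θ₁.Γ ∧
  ∃ (q : Q) (d : D),
    -- applying a transition of δ to a ⊥-thread
    ((∃ tr ∈ δ, (q, TA.bot, d) ∈ θ₁.Δ ∧
        θ₂.Δ = (θ₁.Δ \ {(q, TA.bot, d)}) ∪
          {x | x.1 = q ∧ x.2.2 = d ∧ x.2.1 ∈ taSet tr}) ∨
    -- univ
    (∃ p : Q, (q, TA.act (NAct.univ p), d) ∈ θ₁.Δ ∧
        θ₂.Δ = (θ₁.Δ \ {(q, TA.act (NAct.univ p), d)}) ∪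
          {x | x.1 = p ∧ x.2.1 = TA.top ∧ ∃ μ : S, (μ, x.2.2) ∈ θ₁.Γ}) ∨
    -- guess
    (∃ (p : Q) (d' : D), (q, TA.act (NAct.guess p), d) ∈ θ₁.Δ ∧
        θ₂.Δ = (θ₁.Δ \ {(q, TA.act (NAct.guess p), d)}) ∪ {(p, TA.topg, d')}) ∨
    -- store
    (∃ (p : Q) (d' : D), (q, TA.act (NAct.store p), d) ∈ θ₁.Δ ∧
        d' ∈ θ₁.rootData ∧
        θ₂.Δ = (θ₁.Δ \ {(q, TA.act (NAct.store p), d)}) ∪ {(p, TA.top, d')}) ∨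
    -- keep
    (∃ p : Q, (q, TA.act (NAct.keep p), d) ∈ θ₁.Δ ∧
        θ₂.Δ = (θ₁.Δ \ {(q, TA.act (NAct.keep p), d)}) ∪ {(p, TA.top, d)}) ∨
    -- accept
    ((q, TA.act NAct.accept, d) ∈ θ₁.Δ ∧
        θ₂.Δ = θ₁.Δ \ {(q, TA.act NAct.accept, d)}) ∨
    -- a (possibly negated) basic test, deleted if it holds
    (∃ (neg : Bool) (t : NTest Q S), (q, TA.test neg t, d) ∈ θ₁.Δ ∧
        taTestHolds θ₁ q d neg t ∧
        θ₂.Δ = θ₁.Δ \ {(q, TA.test neg t, d)}))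

/-- The transition `→inc(S, χ)`. -/
def incStep (Sq : Set (Q × TA Q S)) (χ : Set S) (θ₁ θ₂ : EConf A B Q S D h) :
    Prop :=
  (∃ d : D, θ₁.dfun d = Sq ∧ θ₁.gfun d = χ) ∧
  (∃ e₁ e₂ : D, e₁ ≠ e₂ ∧ θ₁.gfun e₁ = χ ∧ θ₁.gfun e₂ = χ) ∧
  ∃ e : D, e ∉ θ₁.dataset ∧ θ₂.r = θ₁.r ∧ θ₂.m = θ₁.m ∧
    (∀ d : D, d ≠ e → θ₂.dfun d = θ₁.dfun d ∧ θ₂.gfun d = θ₁.gfun d) ∧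
    θ₂.dfun e = {qa ∈ Sq | qa.2 ≠ TA.topg} ∧ θ₂.gfun e = χ

/-- The transition `→inc`. -/
def inc (θ₁ θ₂ : EConf A B Q S D h) : Prop :=
  ∃ (Sq : Set (Q × TA Q S)) (χ : Set S), incStep Sq χ θ₁ θ₂

/-- The transition `→grow`, adding a new root on top. -/
def growStep [Semigroup S] (θ₁ θ₂ : EConf A B Q S D h) : Prop :=
  θ₁.r = false ∧ θ₁.m = false ∧
  (∀ x ∈ θ₁.Δ, x.2.1 = TA.top ∨ x.2.1 = TA.topg) ∧
  θ₂.Δ = {x | x.2.1 = TA.bot ∧ ∃ α : TA Q S, (x.1, α, x.2.2) ∈ θ₁.Δ} ∧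
  ∃ (c : A × B) (d' : D),
    θ₂.Γ = {y | ∃ μ : S, ∃ e : D, (μ, e) ∈ θ₁.Γ ∧ y = (h c * μ, e)} ∪ {(h c, d')}

/-- The transition `→merge`, merging two extended configurations with the same
label and data value. -/
def mergeStep (θ₁ θ₂ θ₀ : EConf A B Q S D h) : Prop :=
  θ₁.rootInfo = θ₂.rootInfo ∧ θ₀.rootInfo = θ₁.rootInfo ∧
  θ₁.m = true ∧ θ₂.m = true ∧ θ₀.r = θ₁.r ∧ θ₁.r = θ₂.r ∧
  θ₀.Δ = θ₁.Δ ∪ θ₂.Δ ∧ θ₀.Γ = θ₁.Γ ∪ θ₂.Γ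

/-- Any single (ε-, inc- or grow-) transition step of the transition system. -/
def anyStep [Semigroup S] (δ : List (NTrans Q S)) (θ₁ θ₂ : EConf A B Q S D h) :
    Prop :=
  epsStep δ θ₁ θ₂ ∨ inc θ₁ θ₂ ∨ growStep θ₁ θ₂

/-- `Θ ⟹ θ`: one derivation step from a set of extended configurations. -/
def stepFrom [Semigroup S] (δ : List (NTrans Q S))
    (Θ : Set (EConf A B Q S D h)) (θ : EConf A B Q S D h) : Prop :=
  (∃ θ₁ ∈ Θ, anyStep δ θ₁ θ) ∨ ∃ θ₁ ∈ Θ, ∃ θ₂ ∈ Θ, mergeStep θ₁ θ₂ θ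

/-- `Θ ⟹⁺ θ`. -/
inductive Derives [Semigroup S] (δ : List (NTrans Q S)) :
    Set (EConf A B Q S D h) → EConf A B Q S D h → Prop where
  | base {Θ : Set (EConf A B Q S D h)} {θ : EConf A B Q S D h} :
      stepFrom δ Θ θ → Derives δ Θ θ
  | step {Θ : Set (EConf A B Q S D h)} {θ' θ : EConf A B Q S D h} :
      stepFrom δ Θ θ' → Derives δ (Θ ∪ {θ'}) θ → Derives δ Θ θ

/-- `Θ ⟹ⁿ θ`: derivation in at most `n` steps. -/
inductive DerivesN [Semigroup S] (δ : List (NTrans Q S)) :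
    ℕ → Set (EConf A B Q S D h) → EConf A B Q S D h → Prop where
  | base {n : ℕ} {Θ : Set (EConf A B Q S D h)} {θ : EConf A B Q S D h} :
      stepFrom δ Θ θ → DerivesN δ (n + 1) Θ θ
  | step {n : ℕ} {Θ : Set (EConf A B Q S D h)} {θ' θ : EConf A B Q S D h} :
      stepFrom δ Θ θ' → DerivesN δ n (Θ ∪ {θ'}) θ → DerivesN δ (n + 1) Θ θ

/-- `n`-fold composition of a binary relation. -/
def relPow {α : Type} (R : α → α → Prop) : ℕ → α → α → Prop
  | 0 => Eq
  | n + 1 => fun a c => ∃ b, R a b ∧ relPow R n b c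

/-- An initial extended configuration (abstracting a leaf). -/
def Initial (q0 : Q) (θ : EConf A B Q S D h) : Prop :=
  (∃ d : D, θ.Δ = {(q0, TA.bot, d)}) ∧
  ∃ (c : A × B) (d' : D), θ.Γ = {(h c, d')}

/-- An accepting extended configuration: no remaining threads. -/
def Accepting (θ : EConf A B Q S D h) : Prop := θ.Δ = ∅

/-- Truth of a possibly negated test, depending only on `Γ` and `r`. -/
def tH (Γ : Set (S × D)) (r : Bool) (q : Q) (d : D) (neg : Bool) : NTest Q S → Prop
  | .state p => if neg then ¬ q = p else q = p
  | .deq μ => if neg then ¬ (μ, d) ∈ Γ else (μ, d) ∈ Γ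
  | .dneq μ => if neg then ¬ ∃ e : D, e ≠ d ∧ (μ, e) ∈ Γ else ∃ e : D, e ≠ d ∧ (μ, e) ∈ Γ
  | .root => if neg then ¬ r = true else r = true

theorem tH_iff (θ : EConf A B Q S D h) (q : Q) (d : D) (neg : Bool) (t : NTest Q S) :
    taTestHolds θ q d neg t ↔ tH θ.Γ θ.r q d neg t := by
  cases t <;> rfl

/-- The thread `(q, α, d)` may be replaced by the set of threads `Add`. -/
inductive EA (h : A × B → S) (δ : List (NTrans Q S)) (Γ : Set (S × D)) (r : Bool) :
    Q → TA Q S → D → Set (Q × TA Q S × D) → Prop where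
  | bot (q : Q) (d : D) (tr : NTrans Q S) (htr : tr ∈ δ) :
      EA h δ Γ r q TA.bot d {x | x.1 = q ∧ x.2.2 = d ∧ x.2.1 ∈ taSet tr}
  | univ (q : Q) (d : D) (p : Q) :
      EA h δ Γ r q (TA.act (NAct.univ p)) d
        {x | x.1 = p ∧ x.2.1 = TA.top ∧ ∃ μ : S, (μ, x.2.2) ∈ Γ}
  | guess (q : Q) (d : D) (p : Q) (d' : D) :
      EA h δ Γ r q (TA.act (NAct.guess p)) d {(p, TA.topg, d')}
  | store (q : Q) (d : D) (p : Q) (d' : D) (hr : ∃ μ : S, (μ, d') ∈ Γ ∧ ∃ c : A × B, μ = h c) :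
      EA h δ Γ r q (TA.act (NAct.store p)) d {(p, TA.top, d')}
  | keep (q : Q) (d : D) (p : Q) :
      EA h δ Γ r q (TA.act (NAct.keep p)) d {(p, TA.top, d)}
  | accept (q : Q) (d : D) : EA h δ Γ r q (TA.act NAct.accept) d ∅
  | test (q : Q) (d : D) (neg : Bool) (t : NTest Q S) (ht : tH Γ r q d neg t) :
      EA h δ Γ r q (TA.test neg t) d ∅

theorem epsStep_iff (δ : List (NTrans Q S)) (θ₁ θ₂ : EConf A B Q S D h) :
    epsStep δ θ₁ θ₂ ↔ θ₁.m = false ∧ θ₂.m = false ∧ θ₂.r = θ₁.r ∧ θ₂.Γ = θ₁.Γ ∧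
      ∃ q α d Add, EA h δ θ₁.Γ θ₁.r q α d Add ∧ (q, α, d) ∈ θ₁.Δ ∧
        θ₂.Δ = (θ₁.Δ \ {(q, α, d)}) ∪ Add := by
  unfold epsStep
  refine and_congr_right fun _ => and_congr_right fun _ => and_congr_right fun _ =>
    and_congr_right fun _ => ?_
  constructor
  · rintro ⟨q, d, H⟩
    rcases H with ⟨tr, htr, h1, h2⟩ | ⟨p, h1, h2⟩ | ⟨p, d', h1, h2⟩ | ⟨p, d', h1, h3, h2⟩ |
      ⟨p, h1, h2⟩ | ⟨h1, h2⟩ | ⟨neg, t, h1, h3, h2⟩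
    · exact ⟨_, _, _, _, .bot q d tr htr, h1, h2⟩
    · exact ⟨_, _, _, _, .univ q d p, h1, h2⟩
    · exact ⟨_, _, _, _, .guess q d p d', h1, h2⟩
    · exact ⟨_, _, _, _, .store q d p d' h3, h1, h2⟩
    · exact ⟨_, _, _, _, .keep q d p, h1, h2⟩
    · exact ⟨_, _, _, _, .accept q d, h1, by simpa using h2⟩
    · exact ⟨_, _, _, _, .test q d neg t ((tH_iff _ _ _ _ _).1 h3), h1, by simpa using h2⟩
  · rintro ⟨q, α, d, Add, H, h1, h2⟩
    refine ⟨q, d, ?_⟩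
    cases H with
    | bot _ tr htr => exact .inl ⟨tr, htr, h1, h2⟩
    | univ _ p => exact .inr (.inl ⟨p, h1, h2⟩)
    | guess _ p d' => exact .inr (.inr (.inl ⟨p, d', h1, h2⟩))
    | store _ p d' hr => exact .inr (.inr (.inr (.inl ⟨p, d', h1, hr, h2⟩)))
    | keep _ p => exact .inr (.inr (.inr (.inr (.inl ⟨p, h1, h2⟩))))
    | accept => exact .inr (.inr (.inr (.inr (.inr (.inl ⟨h1, by simpa using h2⟩)))))
    | test _ neg t ht =>
      exact .inr (.inr (.inr (.inr (.inr (.inr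
        ⟨neg, t, h1, (tH_iff _ _ _ _ _).2 ht, by simpa using h2⟩)))))

theorem taSet_tag (tr : NTrans Q S) (x : TA Q S) (hx : x ∈ taSet tr) :
    x ≠ TA.bot ∧ x ≠ TA.topg := by
  rcases hx with ⟨_, _, rfl⟩ | ⟨_, _, rfl⟩ <;> simp

theorem EA.tag {δ : List (NTrans Q S)} {Γ : Set (S × D)} {r : Bool} {q : Q} {α : TA Q S} {d : D}
    {Add : Set (Q × TA Q S × D)} (H : EA h δ Γ r q α d Add) :
    α ≠ TA.topg ∧ ∀ x ∈ Add, x.2.1 ≠ α := by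
  cases H with
  | bot _ tr htr => exact ⟨by simp, fun x hx => (taSet_tag tr _ hx.2.2).1⟩
  | univ _ p => refine ⟨by simp, fun x hx => ?_⟩; rw [hx.2.1]; simp
  | guess _ p d' => simp
  | store _ p d' hr => simp
  | keep _ p => simp
  | accept => simp
  | test _ neg t ht => simp

/-- Moving the consumed thread to another value absent from `Γ`. -/
theorem EA.move {δ : List (NTrans Q S)} {Γ : Set (S × D)} {r : Bool} {q : Q} {α : TA Q S} {e e' : D}
    {Add : Set (Q × TA Q S × D)} (H : EA h δ Γ r q α e Add)
    (he : ∀ μ, (μ, e) ∉ Γ) (he' : ∀ μ, (μ, e') ∉ Γ) (ha : ∀ q α, (q, α, e) ∉ Add) :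
    EA h δ Γ r q α e' Add := by
  cases H with
  | bot _ tr htr =>
    have hn : ∀ y, y ∉ taSet tr := fun y hy => ha q y ⟨rfl, rfl, hy⟩
    convert EA.bot q e' tr htr using 1
    ext x; simp [hn]
  | univ _ p => exact .univ _ _ _
  | guess _ p d' => exact .guess _ _ _ _
  | store _ p d' hr => exact .store _ _ _ _ hr
  | keep _ p => exact absurd rfl (ha p TA.top)
  | accept => exact .accept _ _
  | test _ neg t ht =>
    refine .test _ _ _ _ ?_
    cases t with
    | state p => exact ht
    | deq μ => simpa [tH, he, he'] using ht
    | dneq μ =>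
      have : (∃ x : D, x ≠ e ∧ (μ, x) ∈ Γ) ↔ (∃ x : D, x ≠ e' ∧ (μ, x) ∈ Γ) := by
        constructor
        · rintro ⟨x, _, hx⟩; exact ⟨x, fun hh => he' _ (hh ▸ hx), hx⟩
        · rintro ⟨x, _, hx⟩; exact ⟨x, fun hh => he _ (hh ▸ hx), hx⟩
      simp only [tH] at ht ⊢
      rwa [← this]
    | root => exact ht

theorem dataset_finite (θ : EConf A B Q S D h) : θ.dataset.Finite := by
  refine ((θ.finΔ.image (fun x => x.2.2)).union (θ.finΓ.image (fun x => x.2))).subset ?_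
  rintro d (⟨qa, hh⟩ | ⟨μ, hh⟩)
  · exact .inl ⟨_, hh, rfl⟩
  · exact .inr ⟨_, hh, rfl⟩

theorem simEquiv_refl (θ : EConf A B Q S D h) : simEquiv θ θ :=
  ⟨Equiv.refl D, rfl, rfl, rfl, rfl⟩

/-- Up to `∼`, a value absent from the target of an ε-step is absent from the source. -/
theorem eps_fresh [Infinite D] (δ : List (NTrans Q S)) (θ₁ θ₂ : EConf A B Q S D h)
    (H : epsStep δ θ₁ θ₂) (e : D) (he : e ∉ θ₂.dataset) :
    ∃ θh : EConf A B Q S D h, simEquiv θh θ₁ ∧ epsStep δ θh θ₂ ∧ e ∉ θh.dataset := by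
  classical
  by_cases hc : e ∉ θ₁.dataset
  · exact ⟨θ₁, simEquiv_refl _, H, hc⟩
  rw [epsStep_iff] at H
  obtain ⟨m1, m2, hr, hΓ, q, α, d, Add, hE, hmem, hΔ⟩ := H
  have heΔ : ∀ q α, (q, α, e) ∉ θ₂.Δ := fun q α hh => he (.inl ⟨(q, α), hh⟩)
  have heΓ : ∀ μ, (μ, e) ∉ θ₁.Γ := fun μ hh => he (.inr ⟨μ, hΓ ▸ hh⟩)
  have hone : ∀ q' α', (q', α', e) ∈ θ₁.Δ → (q', α', e) = (q, α, d) := by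
    intro q' α' hh
    by_contra hne
    exact heΔ q' α' (hΔ ▸ .inl ⟨hh, hne⟩)
  have hde : d = e := by
    rcases not_not.1 hc with ⟨qa, hh⟩ | ⟨μ, hh⟩
    · have := hone _ _ hh
      simp only [Prod.mk.injEq] at this
      exact this.2.2.symm
    · exact absurd hh (heΓ μ)
  subst hde
  obtain ⟨e', he'⟩ := ((dataset_finite θ₁).union (dataset_finite θ₂)).exists_notMem
  have he1 : ∀ q α, (q, α, e') ∉ θ₁.Δ := fun q α hh => he' (.inl (.inl ⟨(q, α), hh⟩))
  have he2 : ∀ μ, (μ, e') ∉ θ₁.Γ := fun q hh => he' (.inl (.inr ⟨q, hh⟩))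
  have hne : e' ≠ d := fun hh => he1 q α (hh ▸ hmem)
  refine ⟨⟨(θ₁.Δ \ {(q, α, d)}) ∪ {(q, α, e')}, θ₁.Γ, θ₁.r, θ₁.m,
    θ₁.finΔ.sdiff.union (Set.finite_singleton _), θ₁.finΓ, θ₁.uniq⟩, ?_, ?_, ?_⟩
  · refine ⟨Equiv.swap d e', ?_, ?_, rfl, rfl⟩
    · ext ⟨a, b, x⟩
      by_cases hx : x = d
      · subst hx
        have := hone a b
        simp only [Prod.mk.injEq, and_true] at this
        simp [he1]
        constructor
        · exact this
        · rintro ⟨rfl, rfl⟩; exact hmem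
      · by_cases hx' : x = e'
        · subst hx'
          have := hone a b
          simp only [Prod.mk.injEq, and_true] at this
          simp [he1, hne.symm]
          tauto
        · simp [Equiv.swap_apply_of_ne_of_ne hx hx', hx, hx']
    · ext ⟨a, x⟩
      by_cases hx : x = d
      · subst hx; simp [he2, heΓ]
      · by_cases hx' : x = e'
        · subst hx'; simp [he2, heΓ]
        · simp [Equiv.swap_apply_of_ne_of_ne hx hx']
  · rw [epsStep_iff]
    refine ⟨m1, m2, hr, hΓ, q, α, e', Add, hE.move heΓ he2 (fun a b hh => heΔ a b (hΔ ▸ .inr hh)),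
      .inr rfl, ?_⟩
    rw [hΔ]
    ext ⟨a, b, x⟩
    have := he1 a b
    simp only [Set.mem_union, Set.mem_sdiff, Set.mem_singleton_iff, Prod.mk.injEq]
    grind
  · rintro (⟨qa, hh⟩ | ⟨μ, hh⟩)
    · rcases hh with hh | hh
      · exact hh.2 (hone _ _ hh.1)
      · simp only [Set.mem_singleton_iff, Prod.mk.injEq] at hh
        exact hne hh.2.2.symm
    · exact heΓ μ hh

/-- Tests are not affected by adding one more value with the same `Γ`-type. -/
theorem tH_inc {Γ Γ' : Set (S × D)} {r : Bool} {q : Q} {d e d0 : D} {χ : Set S} {neg : Bool}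
    {t : NTest Q S}
    (hΓ : ∀ μ x, (μ, x) ∈ Γ' ↔ (μ, x) ∈ Γ ∨ (x = e ∧ μ ∈ χ)) (heΓ : ∀ μ, (μ, e) ∉ Γ)
    (h0 : ∀ μ, (μ, d0) ∈ Γ ↔ μ ∈ χ)
    (h2 : ∀ μ ∈ χ, ∃ e₁ e₂ : D, e₁ ≠ e₂ ∧ (μ, e₁) ∈ Γ ∧ (μ, e₂) ∈ Γ)
    (ht : tH Γ r q d neg t) (hd : d ≠ e) :
    tH Γ' r q d neg t ∧ (d = d0 → tH Γ' r q e neg t) := by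
  cases t with
  | state p => exact ⟨ht, fun _ => ht⟩
  | root => exact ⟨ht, fun _ => ht⟩
  | deq μ =>
    have a1 : (μ, d) ∈ Γ' ↔ (μ, d) ∈ Γ := by simp [hΓ, hd]
    refine ⟨by simpa only [tH, a1] using ht, ?_⟩
    rintro rfl
    have a2 : (μ, e) ∈ Γ' ↔ (μ, d) ∈ Γ := by simp [hΓ, heΓ, h0]
    simpa only [tH, a2] using ht
  | dneq μ =>
    have key : ∀ y, μ ∈ χ → ∃ x, x ≠ y ∧ (μ, x) ∈ Γ := by
      intro y hy
      obtain ⟨e₁, e₂, hne, i1, i2⟩ := h2 μ hy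
      by_cases hh : e₁ = y
      · exact ⟨e₂, fun h' => hne (hh.trans h'.symm), i2⟩
      · exact ⟨e₁, hh, i1⟩
    have a1 : (∃ x : D, x ≠ d ∧ (μ, x) ∈ Γ') ↔ (∃ x : D, x ≠ d ∧ (μ, x) ∈ Γ) := by
      constructor
      · rintro ⟨x, hx, hm⟩
        rcases (hΓ _ _).1 hm with hm | ⟨_, hm⟩
        · exact ⟨x, hx, hm⟩
        · exact key d hm
      · rintro ⟨x, hx, hm⟩; exact ⟨x, hx, (hΓ _ _).2 (.inl hm)⟩
    refine ⟨by simpa only [tH, a1] using ht, ?_⟩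
    rintro rfl
    have a2 : (∃ x : D, x ≠ e ∧ (μ, x) ∈ Γ') ↔ (∃ x : D, x ≠ d ∧ (μ, x) ∈ Γ) := by
      constructor
      · rintro ⟨x, hx, hm⟩
        rcases (hΓ _ _).1 hm with hm | ⟨_, hm⟩
        · by_cases hxd : x = d
          · subst hxd; exact key x ((h0 _).1 hm)
          · exact ⟨x, hxd, hm⟩
        · exact key d hm
      · rintro ⟨x, hx, hm⟩
        exact ⟨x, fun hh => heΓ _ (hh ▸ hm), (hΓ _ _).2 (.inl hm)⟩
    simpa only [tH, a2] using ht

theorem EA.inc {δ : List (NTrans Q S)} {Γ Γ' : Set (S × D)} {r : Bool} {q : Q} {α : TA Q S}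
    {d e d0 : D} {χ : Set S} {Add : Set (Q × TA Q S × D)} (H : EA h δ Γ r q α d Add)
    (hΓ : ∀ μ x, (μ, x) ∈ Γ' ↔ (μ, x) ∈ Γ ∨ (x = e ∧ μ ∈ χ)) (heΓ : ∀ μ, (μ, e) ∉ Γ)
    (h0 : ∀ μ, (μ, d0) ∈ Γ ↔ μ ∈ χ)
    (h2 : ∀ μ ∈ χ, ∃ e₁ e₂ : D, e₁ ≠ e₂ ∧ (μ, e₁) ∈ Γ ∧ (μ, e₂) ∈ Γ)
    (hroot : ∀ c, h c ∉ χ) (hd : d ≠ e) (h0e : d0 ≠ e) :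
    ∃ Add1, EA h δ Γ' r q α d Add1 ∧
      (d ≠ d0 → ∀ a b x, (a, b, x) ∈ Add1 ↔
        (a, b, x) ∈ Add ∨ (x = e ∧ (a, b, d0) ∈ Add ∧ b ≠ TA.topg)) ∧
      (d = d0 → ∃ Add2, EA h δ Γ' r q α e Add2 ∧ ∀ a b x, ((a, b, x) ∈ Add1 ∨ (a, b, x) ∈ Add2) ↔
        (a, b, x) ∈ Add ∨ (x = e ∧ (a, b, d0) ∈ Add ∧ b ≠ TA.topg)) := by
  cases H with
  | bot _ tr htr =>
    refine ⟨_, .bot q d tr htr, ?_, ?_⟩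
    · intro hdd a b x
      simp [hdd.symm]
    · rintro rfl
      refine ⟨_, .bot q e tr htr, ?_⟩
      intro a b x
      have := taSet_tag tr b
      simp
      tauto
  | univ _ p =>
    have key : ∀ a b x, ((a, b, x) ∈ {x : Q × TA Q S × D | x.1 = p ∧ x.2.1 = TA.top ∧ ∃ μ : S, (μ, x.2.2) ∈ Γ'}) ↔
        (a, b, x) ∈ {x : Q × TA Q S × D | x.1 = p ∧ x.2.1 = TA.top ∧ ∃ μ : S, (μ, x.2.2) ∈ Γ} ∨
        (x = e ∧ (a, b, d0) ∈ {x : Q × TA Q S × D | x.1 = p ∧ x.2.1 = TA.top ∧ ∃ μ : S, (μ, x.2.2) ∈ Γ} ∧ b ≠ TA.topg) := by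
      intro a b x
      simp only [Set.mem_ofPred_eq, hΓ, h0, exists_or, exists_and_left]
      constructor
      · rintro ⟨rfl, rfl, hh | hh⟩
        · exact .inl ⟨rfl, rfl, hh⟩
        · exact .inr ⟨hh.1, ⟨rfl, rfl, hh.2⟩, by simp⟩
      · tauto
    refine ⟨_, .univ q d p, fun _ => key, fun _ => ⟨_, .univ q e p, ?_⟩⟩
    intro a b x
    rw [or_self]; exact key a b x
  | guess _ p d' =>
    have key : ∀ a b x, ((a, b, x) ∈ ({(p, TA.topg, d')} : Set (Q × TA Q S × D))) ↔
        (a, b, x) ∈ ({(p, TA.topg, d')} : Set (Q × TA Q S × D)) ∨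
        (x = e ∧ (a, b, d0) ∈ ({(p, TA.topg, d')} : Set (Q × TA Q S × D)) ∧ b ≠ TA.topg) := by
      intro a b x
      simp
      tauto
    refine ⟨_, .guess q d p d', fun _ => key, fun _ => ⟨_, .guess q e p d', ?_⟩⟩
    intro a b x
    rw [or_self]; exact key a b x
  | store _ p d' hr =>
    obtain ⟨μ, hm, c, rfl⟩ := hr
    have hr' : ∃ μ : S, (μ, d') ∈ Γ' ∧ ∃ c : A × B, μ = h c := ⟨_, (hΓ _ _).2 (.inl hm), c, rfl⟩
    have hne : d0 ≠ d' := by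
      rintro rfl
      exact hroot c ((h0 _).1 hm)
    have key : ∀ a b x, ((a, b, x) ∈ ({(p, TA.top, d')} : Set (Q × TA Q S × D))) ↔
        (a, b, x) ∈ ({(p, TA.top, d')} : Set (Q × TA Q S × D)) ∨
        (x = e ∧ (a, b, d0) ∈ ({(p, TA.top, d')} : Set (Q × TA Q S × D)) ∧ b ≠ TA.topg) := by
      intro a b x
      simp [hne]
    refine ⟨_, .store q d p d' hr', fun _ => key, fun _ => ⟨_, .store q e p d' hr', ?_⟩⟩
    intro a b x
    rw [or_self]; exact key a b x
  | keep _ p =>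
    refine ⟨_, .keep q d p, ?_, ?_⟩
    · intro hdd a b x
      simp [hdd.symm]
    · rintro rfl
      refine ⟨_, .keep q e p, ?_⟩
      intro a b x
      have : b = TA.top → b ≠ TA.topg := by rintro rfl; simp
      simp
      tauto
  | accept => exact ⟨_, .accept q d, by simp, fun _ => ⟨_, .accept q e, by simp⟩⟩
  | test _ neg t ht =>
    have := tH_inc hΓ heΓ h0 h2 ht hd
    exact ⟨_, .test q d neg t this.1, by simp, fun hh => ⟨_, .test q e neg t (this.2 hh), by simp⟩⟩

/-- **Commutation of inc with ε-transitions (Lemma 3.14)**: if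
`θ₁ →ε θ₂ →inc(S,χ) θ₃`, then for some `θ̂₁ ∼ θ₁` and some `S'` either
`θ̂₁ →inc(S',χ) θ' →ε θ₃`, or `θ̂₁ →inc(S',χ) θ' →ε θ'' →ε θ₃`. -/
theorem inc_commutes_with_eps (A B Q S D : Type) [Fintype A] [Fintype B]
    [Fintype Q] [Fintype S] [Semigroup S] [Infinite D] (h : A × B → S)
    (hNF1 : NF1 h) (δ : List (NTrans Q S))
    (θ₁ θ₂ θ₃ : EConf A B Q S D h)
    (Sq : Set (Q × TA Q S)) (χ : Set S)
    (h₁₂ : epsStep δ θ₁ θ₂) (h₂₃ : incStep Sq χ θ₂ θ₃) :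
    ∃ (θh₁ θ' : EConf A B Q S D h) (Sq' : Set (Q × TA Q S)),
      simEquiv θh₁ θ₁ ∧
      ((incStep Sq' χ θh₁ θ' ∧ epsStep δ θ' θ₃) ∨
       ∃ θ'' : EConf A B Q S D h,
         incStep Sq' χ θh₁ θ' ∧ epsStep δ θ' θ'' ∧ epsStep δ θ'' θ₃) := by
  have h₂₃' := h₂₃
  obtain ⟨⟨d0, hd0, hg0⟩, ⟨e₁, e₂, h12, hg1, hg2⟩, e, he, hr3, hm3, hoth, hde, hge⟩ := h₂₃
  obtain ⟨θh, hsim, hε, hfr⟩ := eps_fresh δ θ₁ θ₂ h₁₂ e he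
  -- choose the copied value different from `e`
  obtain ⟨d0, h0e, hd0, hg0⟩ : ∃ d0, d0 ≠ e ∧ θ₂.dfun d0 = Sq ∧ θ₂.gfun d0 = χ := by
    by_cases hc : d0 = e
    · subst hc
      obtain ⟨f, hf⟩ := ((dataset_finite θ₂).union (Set.finite_singleton d0)).exists_notMem
      have emp : ∀ x, x ∉ θ₂.dataset → θ₂.dfun x = ∅ ∧ θ₂.gfun x = ∅ := by
        intro x hx
        constructor
        · ext qa; simp only [Set.mem_empty_iff_false, iff_false]
          exact fun hh => hx (.inl ⟨qa, hh⟩)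
        · ext μ; simp only [Set.mem_empty_iff_false, iff_false]
          exact fun hh => hx (.inr ⟨μ, hh⟩)
      refine ⟨f, fun hh => hf (.inr hh), ?_, ?_⟩
      · rw [← hd0, (emp f fun hh => hf (.inl hh)).1, (emp d0 he).1]
      · rw [← hg0, (emp f fun hh => hf (.inl hh)).2, (emp d0 he).2]
    · exact ⟨d0, hc, hd0, hg0⟩
  rw [epsStep_iff] at hε
  obtain ⟨m1, m2, hr, hΓ, q, α, d, Add, hE, hmem, hΔ⟩ := hε
  have heΔ2 : ∀ a b, (a, b, e) ∉ θ₂.Δ := fun a b hh => he (.inl ⟨(a, b), hh⟩)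
  have heΔ : ∀ a b, (a, b, e) ∉ θh.Δ := fun a b hh => hfr (.inl ⟨(a, b), hh⟩)
  have heΓ : ∀ μ, (μ, e) ∉ θh.Γ := fun μ hh => hfr (.inr ⟨μ, hh⟩)
  have hdne : d ≠ e := fun hh => heΔ q α (hh ▸ hmem)
  have hgfun : ∀ x, θh.gfun x = θ₂.gfun x := by
    intro x; simp only [EConf.gfun, hΓ]
  have k0 : ∀ μ, (μ, d0) ∈ θh.Γ ↔ μ ∈ χ := by
    intro μ; rw [← hg0, ← hgfun]; rfl
  have k1 : ∀ μ, (μ, e₁) ∈ θh.Γ ↔ μ ∈ χ := by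
    intro μ; rw [← hg1, ← hgfun]; rfl
  have k2 : ∀ μ, (μ, e₂) ∈ θh.Γ ↔ μ ∈ χ := by
    intro μ; rw [← hg2, ← hgfun]; rfl
  have hΓ3 : ∀ μ x, (μ, x) ∈ θ₃.Γ ↔ (μ, x) ∈ θh.Γ ∨ (x = e ∧ μ ∈ χ) := by
    intro μ x
    by_cases hx : x = e
    · subst hx
      have : μ ∈ θ₃.gfun x ↔ μ ∈ χ := by rw [hge]
      have t : (μ, x) ∈ θ₃.Γ ↔ μ ∈ χ := this
      simp [t, heΓ]
    · have : μ ∈ θ₃.gfun x ↔ μ ∈ θh.gfun x := by rw [(hoth x hx).2, hgfun]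
      have t : (μ, x) ∈ θ₃.Γ ↔ (μ, x) ∈ θh.Γ := this
      simp [t, hx]
  have hΔ3 : ∀ a b x, (a, b, x) ∈ θ₃.Δ ↔ (a, b, x) ∈ θ₂.Δ ∨
      (x = e ∧ (a, b, d0) ∈ θ₂.Δ ∧ b ≠ TA.topg) := by
    intro a b x
    by_cases hx : x = e
    · subst hx
      have : (a, b) ∈ θ₃.dfun x ↔ (a, b) ∈ θ₂.dfun d0 ∧ b ≠ TA.topg := by rw [hde, hd0]; rfl
      have t : (a, b, x) ∈ θ₃.Δ ↔ (a, b, d0) ∈ θ₂.Δ ∧ b ≠ TA.topg := this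
      simp [t, heΔ2]
    · have : (a, b) ∈ θ₃.dfun x ↔ (a, b) ∈ θ₂.dfun x := by rw [(hoth x hx).1]
      have t : (a, b, x) ∈ θ₃.Δ ↔ (a, b, x) ∈ θ₂.Δ := this
      simp [t, hx]
  have h2 : ∀ μ ∈ χ, ∃ e₁ e₂ : D, e₁ ≠ e₂ ∧ (μ, e₁) ∈ θh.Γ ∧ (μ, e₂) ∈ θh.Γ :=
    fun μ hμ => ⟨e₁, e₂, h12, (k1 μ).2 hμ, (k2 μ).2 hμ⟩
  have hroot : ∀ c, h c ∉ χ := by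
    intro c hc
    have := θh.uniq.unique ⟨(k1 _).2 hc, c, rfl⟩ ⟨(k2 _).2 hc, c, rfl⟩
    simp only [Prod.mk.injEq, true_and] at this
    exact h12 this
  obtain ⟨hαg, -⟩ := hE.tag
  obtain ⟨Add1, hE1, hA, hB⟩ := hE.inc hΓ3 heΓ k0 h2 hroot hdne h0e
  let θ' : EConf A B Q S D h :=
    { Δ := θh.Δ ∪ {x | x.2.2 = e ∧ (x.1, x.2.1, d0) ∈ θh.Δ ∧ x.2.1 ≠ TA.topg}
      Γ := θ₃.Γ
      r := θh.r
      m := false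
      finΔ := by
        refine θh.finΔ.union ((θh.finΔ.image (fun x => (x.1, x.2.1, e))).subset ?_)
        rintro ⟨a, b, x⟩ ⟨hx, hh, _⟩
        simp only at hx
        subst hx
        exact ⟨_, hh, rfl⟩
      finΓ := θ₃.finΓ
      uniq := θ₃.uniq }
  have hΔ' : ∀ a b x, (a, b, x) ∈ θ'.Δ ↔ (a, b, x) ∈ θh.Δ ∨
    (x = e ∧ (a, b, d0) ∈ θh.Δ ∧ b ≠ TA.topg) := fun a b x => Iff.rfl
  have hinc : incStep (θh.dfun d0) χ θh θ' := by
    refine ⟨⟨d0, rfl, by rw [hgfun, hg0]⟩, ⟨e₁, e₂, h12, by rw [hgfun, hg1], by rw [hgfun, hg2]⟩,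
      e, hfr, rfl, m1.symm, ?_, ?_, hge⟩
    · intro x hx
      refine ⟨?_, ?_⟩
      · ext ⟨a, b⟩
        change (a, b, x) ∈ θ'.Δ ↔ (a, b, x) ∈ θh.Δ
        rw [hΔ']; simp [hx]
      · rw [hgfun, ← (hoth x hx).2]; rfl
    · ext ⟨a, b⟩
      change (a, b, e) ∈ θ'.Δ ↔ (a, b, d0) ∈ θh.Δ ∧ b ≠ TA.topg
      rw [hΔ']; simp [heΔ]
  have m3 : θ₃.m = false := hm3.trans m2
  have r3 : θ₃.r = θh.r := hr3.trans hr
  have hΔ2 : ∀ a b x, (a, b, x) ∈ θ₂.Δ ↔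
      ((a, b, x) ∈ θh.Δ ∧ ¬ (a = q ∧ b = α ∧ x = d)) ∨ (a, b, x) ∈ Add := by
    intro a b x; rw [hΔ]; simp
  refine ⟨θh, θ', θh.dfun d0, hsim, ?_⟩
  by_cases hdd : d = d0
  · right
    obtain ⟨Add2, hE2, hB⟩ := hB hdd
    subst hdd
    have tag1 := hE1.tag.2
    have tag2 := hE2.tag.2
    have hΔ'3 : θ₃.Δ = (((θ'.Δ \ {(q, α, d)}) ∪ Add1) \ {(q, α, e)}) ∪ Add2 := by
      ext ⟨a, b, x⟩
      have t1 := tag1 (a, b, x)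
      have B1 := hB a b x
      have hq := heΔ a b
      simp only [Set.mem_union, Set.mem_sdiff, Set.mem_singleton_iff, Prod.mk.injEq]
      rw [hΔ3, hΔ2, hΔ2, hΔ']
      grind
    let θ'' : EConf A B Q S D h :=
      { Δ := (θ'.Δ \ {(q, α, d)}) ∪ Add1
        Γ := θ₃.Γ
        r := θh.r
        m := false
        finΔ := by
          refine (θ₃.finΔ.union (Set.finite_singleton (q, α, e))).subset ?_
          intro y hy
          by_cases hye : y = (q, α, e)
          · exact .inr hye
          · left; rw [hΔ'3]; exact .inl ⟨hy, hye⟩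
        finΓ := θ₃.finΓ
        uniq := θ₃.uniq }
    refine ⟨θ'', hinc, ?_, ?_⟩
    · rw [epsStep_iff]
      exact ⟨rfl, rfl, rfl, rfl, q, α, d, Add1, hE1, (hΔ' _ _ _).2 (.inl hmem), rfl⟩
    · rw [epsStep_iff]
      refine ⟨rfl, m3, r3, rfl, q, α, e, Add2, hE2, .inl ⟨(hΔ' _ _ _).2 (.inr ⟨rfl, hmem, hαg⟩), ?_⟩,
        hΔ'3⟩
      simp [hdne.symm]
  · left
    refine ⟨hinc, ?_⟩
    have hA := hA hdd
    rw [epsStep_iff]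
    refine ⟨rfl, m3, r3, rfl, q, α, d, Add1, hE1, (hΔ' _ _ _).2 (.inl hmem), ?_⟩
    ext ⟨a, b, x⟩
    simp only [Set.mem_union, Set.mem_sdiff, Set.mem_singleton_iff, Prod.mk.injEq]
    rw [hΔ3, hΔ2, hΔ2, hΔ', hA]
    grind

end ECBUDA
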